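/- arXiv:2202.09495 — 2 statements merged into one kernel-verified Lean document; each statement's English description precedes it below -/
import Mathlib

section
/- If S →* T and a bin b is not monochrome under T (i.e., τ_T(b) ≠ 0), then the top color of T b equals (S b)[τ_T(b) + 1]; that is, all units of T b above its top border have the color of the unit of S b lying just above that border. -/
open scoped Classical

noncomputable section

/-- A configuration: each bin holds a list of colors (bottom to top) of length at most `h`. -/
def Config {B C : Type*} (h : ℕ) (S : B → List C) : Prop := ∀ b, (S b).length ≤ h

/-- An initial configuration: every bin is full (length `h`) or empty. -/
def InitConfig {B C : Type*} (h : ℕ) (S : B → List C) : Prop :=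
  ∀ b, (S b).length = h ∨ (S b).length = 0

/-- A sorted (goal) configuration: every bin is empty or monochromatically full. -/
def SortedConfig {B C : Type*} (h : ℕ) (S : B → List C) : Prop :=
  ∀ b, S b = [] ∨ ∃ c, S b = List.replicate h c

/-- A ball-move from `S` to `S'`. -/
def BallMove {B C : Type*} (h : ℕ) (S S' : B → List C) : Prop :=
  ∃ b₁ b₂ c, b₁ ≠ b₂ ∧
    S b₁ = S' b₁ ++ [c] ∧
    (S b₂ = [] ∨ (S b₂).getLast? = some c) ∧
    S' b₂ = S b₂ ++ [c] ∧ (S' b₂).length ≤ h ∧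
    ∀ b, b ≠ b₁ → b ≠ b₂ → S' b = S b

/-- A water-move from `S` to `S'`. -/
def WaterMove {B C : Type*} (h : ℕ) (S S' : B → List C) : Prop :=
  ∃ b₁ b₂ c m, 1 ≤ m ∧ b₁ ≠ b₂ ∧
    S b₁ = S' b₁ ++ List.replicate m c ∧
    (S b₂ = [] ∨ (S b₂).getLast? = some c) ∧
    S' b₂ = S b₂ ++ List.replicate m c ∧ (S' b₂).length ≤ h ∧
    ((S' b₁).getLast? ≠ some c ∨ (S' b₂).length = h) ∧
    ∀ b, b ≠ b₁ → b ≠ b₂ → S' b = S b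

/-- `i` is a border of the list `α` (1-indexed): `i = 0`, or `1 ≤ i < |α|` and `α[i] ≠ α[i+1]`. -/
def IsBorder {C : Type*} (α : List C) (i : ℕ) : Prop :=
  i = 0 ∨ (1 ≤ i ∧ i < α.length ∧ α[i-1]? ≠ α[i]?)

/-- The set `D(α)` of borders of `α`. -/
def borders {C : Type*} (α : List C) : Finset ℕ :=
  (Finset.range (α.length + 1)).filter (IsBorder α)

/-- The top border `max D(α)` of a list. -/
def topBorder {C : Type*} (α : List C) : ℕ := (borders α).sup id

/-- The top-border table `τ_S` of a configuration. -/
def tbt {B C : Type*} (S : B → List C) : B → ℕ := fun b => topBorder (S b)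

/-- `F_c(τ)`: the number of units of color `c` above the borders of `τ` in `S₀`. -/
def Fcnt {B C : Type*} [Fintype B] (h : ℕ) (S₀ : B → List C) (τ : B → ℕ) (c : C) : ℕ :=
  ∑ b, ((Finset.Icc (τ b + 1) h).filter (fun i => (S₀ b)[i-1]? = some c)).card

/-- `B_ε(τ)`: the bins whose top border is `0`. -/
def Beps {B : Type*} [Fintype B] (τ : B → ℕ) : Finset B :=
  Finset.univ.filter (fun b => τ b = 0)

/-- `B_c(τ)`: the non-monochrome bins whose top color is `c` (determined from `S₀`). -/
def Bcol {B C : Type*} [Fintype B] (S₀ : B → List C) (τ : B → ℕ) (c : C) : Finset B :=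
  Finset.univ.filter (fun b => τ b ≠ 0 ∧ (S₀ b)[τ b]? = some c)

/-- `G_c(τ) = Σ_{b ∈ B_c(τ)} (h − τ(b))`. -/
def Gcnt {B C : Type*} [Fintype B] (h : ℕ) (S₀ : B → List C) (τ : B → ℕ) (c : C) : ℕ :=
  ∑ b ∈ Bcol S₀ τ c, (h - τ b)

/-- `M_c(τ) = max(0, ⌈(F_c(τ) − G_c(τ))/h⌉)`. -/
def Mcnt {B C : Type*} [Fintype B] (h : ℕ) (S₀ : B → List C) (τ : B → ℕ) (c : C) : ℕ :=
  (⌈((Fcnt h S₀ τ c : ℚ) - (Gcnt h S₀ τ c : ℚ)) / (h : ℚ)⌉).toNat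

/-- `M_c^b(τ) = max(0, ⌈(F_c(τ) − G_c(τ) + (h − τ(b)))/h⌉)`. -/
def McntB {B C : Type*} [Fintype B] (h : ℕ) (S₀ : B → List C) (τ : B → ℕ) (c : C) (b : B) : ℕ :=
  (⌈((Fcnt h S₀ τ c : ℚ) - (Gcnt h S₀ τ c : ℚ) + ((h : ℚ) - (τ b : ℚ))) / (h : ℚ)⌉).toNat

/-- A configuration `S` is consistent with `S₀`. -/
def Consistent {B C : Type*} [Fintype B] [Fintype C] (h : ℕ) (S₀ S : B → List C) : Prop :=
  ∑ c : C, Mcnt h S₀ (tbt S) c ≤ (Beps (tbt S)).card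

/-- `S` is tight (relative to `S₀`): for every color `c` there are exactly `M_c(τ_S)`
nonempty monochrome bins of color `c`. -/
def Tight {B C : Type*} [Fintype B] [Fintype C] (h : ℕ) (S₀ S : B → List C) : Prop :=
  ∀ c : C,
    (Finset.univ.filter (fun b => S b ≠ [] ∧ ∀ x ∈ S b, x = c)).card = Mcnt h S₀ (tbt S) c

/-- The move `τ ↝_b τ'` on top-border tables (relative to `S₀`). -/
def TBMove {B C : Type*} [Fintype B] [Fintype C] (h : ℕ) (S₀ : B → List C)
    (τ τ' : B → ℕ) (b : B) : Prop :=
  (∀ a, a ≠ b → τ a = τ' a) ∧ 0 < τ b ∧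
  τ' b = ((borders (S₀ b)).filter (fun i => i < τ b)).sup id ∧
  ∑ c : C, McntB h S₀ τ c b ≤ (Beps τ).card

/-- The move `τ ↝ τ'`: `τ ↝_b τ'` for some bin `b`. -/
def TBStep {B C : Type*} [Fintype B] [Fintype C] (h : ℕ) (S₀ : B → List C)
    (τ τ' : B → ℕ) : Prop :=
  ∃ b, TBMove h S₀ τ τ' b

end

/-- Borders are preserved when extending a list at its end. -/
theorem IsBorder.append_right {C : Type*} {α : List C} {i : ℕ} (hi : IsBorder α i) (β : List C) :
    IsBorder (α ++ β) i := by
  rcases hi with rfl | ⟨h1, h2, h3⟩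
  · exact Or.inl rfl
  · refine Or.inr ⟨h1, by simp; omega, ?_⟩
    rwa [List.getElem?_append_left (by omega), List.getElem?_append_left h2]

/-- Stacking a unit on an empty list or on a unit of the same color creates no border. -/
theorem IsBorder.of_append_singleton {C : Type*} {α : List C} {c : C} {i : ℕ}
    (hα : α = [] ∨ α.getLast? = some c) (hi : IsBorder (α ++ [c]) i) : IsBorder α i := by
  rcases hi with rfl | ⟨h1, h2, h3⟩
  · exact Or.inl rfl
  · simp only [List.length_append, List.length_singleton] at h2
    have hlt : i < α.length := by
      by_contra hlt
      obtain rfl : i = α.length := by omega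
      rcases hα with rfl | hα
      · simp at h1
      · apply h3
        rw [List.getElem?_append_left (by omega), ← List.getLast?_eq_getElem?, hα]
        simp
    rw [List.getElem?_append_left (by omega), List.getElem?_append_left hlt] at h3
    exact Or.inr ⟨h1, hlt, h3⟩

theorem IsBorder.lt_length {C : Type*} {α : List C} {i : ℕ} (hi : IsBorder α i) (h0 : i ≠ 0) :
    i < α.length := by
  rcases hi with rfl | ⟨_, h2, _⟩
  · exact absurd rfl h0
  · exact h2

theorem isBorder_topBorder {C : Type*} (α : List C) : IsBorder α (topBorder α) := by
  have hne : (borders α).Nonempty := ⟨0, by simp [borders, IsBorder]⟩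
  obtain ⟨i, hi, heq⟩ := Finset.exists_mem_eq_sup (borders α) hne id
  rw [topBorder, heq]
  exact (Finset.mem_filter.mp hi).2

theorem IsBorder.le_topBorder {C : Type*} {α : List C} {i : ℕ} (hi : IsBorder α i) :
    i ≤ topBorder α := by
  refine Finset.le_sup (f := id) (Finset.mem_filter.mpr ⟨Finset.mem_range.mpr ?_, hi⟩)
  rcases hi with rfl | ⟨_, h2, _⟩ <;> omega

/-- All units above the top border have the same color. -/
theorem getElem?_eq_of_topBorder_le {C : Type*} {α : List C} {j : ℕ} (hj : topBorder α ≤ j)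
    (hlt : j < α.length) : α[j]? = α[topBorder α]? := by
  induction j, hj using Nat.le_induction with
  | base => rfl
  | succ j hj ih =>
    rw [← ih (by omega)]
    by_contra hne
    have hb : IsBorder α (j + 1) := Or.inr ⟨by omega, hlt, fun h => hne h.symm⟩
    have := hb.le_topBorder
    omega

theorem getLast?_eq_getElem?_topBorder {C : Type*} (α : List C) :
    α.getLast? = α[topBorder α]? := by
  rcases eq_or_ne α [] with rfl | hα
  · simp
  · have hpos := List.length_pos_iff.mpr hα
    have hlt : topBorder α < α.length := by
      by_cases h0 : topBorder α = 0
      · omega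
      · exact (isBorder_topBorder α).lt_length h0
    rw [List.getLast?_eq_getElem?]
    exact getElem?_eq_of_topBorder_le (by omega) (by omega)

/-- A ball-move creates no border, and keeps the unit above each surviving nonzero border. -/
theorem BallMove.isBorder {B C : Type*} {h : ℕ} {S S' : B → List C} (hm : BallMove h S S')
    {b : B} {i : ℕ} (hi : IsBorder (S' b) i) (h0 : i ≠ 0) :
    IsBorder (S b) i ∧ (S' b)[i]? = (S b)[i]? := by
  obtain ⟨b₁, b₂, c, -, h₁, htop, h₂, -, hrest⟩ := hm
  rcases eq_or_ne b b₁ with rfl | hb₁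
  · rw [h₁]
    exact ⟨hi.append_right _, (List.getElem?_append_left (hi.lt_length h0)).symm⟩
  rcases eq_or_ne b b₂ with rfl | hb₂
  · rw [h₂] at hi ⊢
    have hi' := hi.of_append_singleton htop
    exact ⟨hi', List.getElem?_append_left (hi'.lt_length h0)⟩
  · rw [hrest b hb₁ hb₂] at hi ⊢
    exact ⟨hi, rfl⟩

/-- The unit above a nonzero border of a reachable configuration is the original one. -/
theorem getElem?_eq_of_isBorder_of_reachable {B C : Type*} {h : ℕ} {S T : B → List C}
    (hST : Relation.ReflTransGen (BallMove h) S T) {b : B} {i : ℕ} (hi : IsBorder (T b) i)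
    (h0 : i ≠ 0) : (T b)[i]? = (S b)[i]? := by
  induction hST with
  | refl => rfl
  | tail _ hm ih =>
    obtain ⟨hi', heq⟩ := hm.isBorder hi h0
    exact heq.trans (ih hi')

/-- if `b` is not monochrome under `T`, the top color of `T b` is the color of
the unit of `S b` lying just above the top border of `T b` (1-indexed position `τ_T(b)+1`). -/
theorem statement_3 {B C : Type*} [Fintype B] [Fintype C] (h : ℕ) (hh : 1 ≤ h)
    (S T : B → List C) (hS : Config h S)
    (hST : Relation.ReflTransGen (BallMove h) S T) (b : B) (hb : tbt T b ≠ 0) :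
    (T b).getLast? = (S b)[tbt T b]? := by
  rw [getLast?_eq_getElem?_topBorder]
  exact getElem?_eq_of_isBorder_of_reachable hST (isBorder_topBorder _) hb
end

section
/- Polynomial-length ball-move solutions: let S₀ be an initial configuration with exactly n full bins (bins b with (S₀ b).length = h). If there exists a sorted configuration T with S₀ →* T, then there exists a sequence of at most (2h − 1)·h·n ball-moves from S₀ to some sorted configuration. -/
open scoped Classical

section BallSort

/-- The part of a list below its topmost monochrome block. -/
noncomputable def stem {C : Type*} (α : List C) : List C := α.rdropWhile (fun x => some x = α.getLast?)

/-- The room left in a bin `α` of capacity `h` for balls of color `c`, if its top color is `c`. -/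
noncomputable def room {C : Type*} (h : ℕ) (c : C) (α : List C) : ℕ :=
  if α.getLast? = some c then h - α.length else 0

/-- Color `c` does not waste a monochrome bin: none has color `c`, or the total room is below `h`. -/
def TightAt {B C : Type*} [Fintype B] (h : ℕ) (c : C) (S : B → List C) : Prop :=
  (∀ b, stem (S b) = [] → (S b).getLast? ≠ some c) ∨ ∑ b, room h c (S b) < h

/-- There is a chain of exactly `k` ball-moves from `S` to `T`. -/
def Steps {B C : Type*} (h : ℕ) : ℕ → (B → List C) → (B → List C) → Prop
  | 0, S, T => S = T
  | k + 1, S, T => ∃ U, BallMove h S U ∧ Steps h k U T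

variable {B C : Type*}

lemma stem_nil : stem ([] : List C) = [] := by simp [stem]

lemma stem_append_singleton (β : List C) (c : C) :
    stem (β ++ [c]) = if β.getLast? = some c then stem β else β := by
  have h1 : stem (β ++ [c]) = β.rdropWhile (fun x => some x = some c) := by
    simp [stem]
  split_ifs with h
  · rw [h1, stem, h]
  · rw [h1]
    rcases List.eq_nil_or_concat β with rfl | ⟨γ, x, rfl⟩
    · simp
    · have : x ≠ c := by simpa using h
      simp [this]

lemma stem_push {β : List C} {c : C} (hβ : β = [] ∨ β.getLast? = some c) :
    stem (β ++ [c]) = stem β := by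
  rw [stem_append_singleton]
  rcases hβ with rfl | h
  · simp [stem_nil]
  · simp [h]

lemma stem_decomp {α : List C} {c : C} (hα : α.getLast? = some c) :
    ∃ k, 1 ≤ k ∧ α = stem α ++ List.replicate k c ∧ (stem α).getLast? ≠ some c := by
  induction α using List.reverseRecOn generalizing c with
  | nil => simp at hα
  | append_singleton β x ih =>
    obtain rfl : x = c := by simpa using hα
    rw [stem_append_singleton]
    split_ifs with h
    · obtain ⟨k, _, h2, h3⟩ := ih h
      refine ⟨k + 1, by omega, ?_, h3⟩
      conv_lhs => rw [h2]
      rw [List.replicate_succ', List.append_assoc]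
    · exact ⟨1, le_rfl, by simp, h⟩

lemma length_stem_le (α : List C) : (stem α).length ≤ α.length := by
  rcases hα : α.getLast? with _ | c
  · rw [List.getLast?_eq_none_iff] at hα
    simp [hα, stem_nil]
  · obtain ⟨k, _, h2, _⟩ := stem_decomp hα
    have := congrArg List.length h2
    simp at this
    omega

lemma stem_replicate (k : ℕ) (c : C) : stem (List.replicate k c) = [] := by
  induction k with
  | zero => simp [stem_nil]
  | succ k ih =>
    rw [List.replicate_succ', stem_push, ih]
    rcases k with _ | k
    · simp
    · simp [List.getLast?_replicate]

lemma count_add_room {h : ℕ} {α : List C} (hα : α.length ≤ h) (c : C) :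
    α.count c + room h c α = (stem α).count c +
      (if stem α ≠ [] ∧ α.getLast? = some c then h - (stem α).length else 0) +
      h * (if stem α = [] ∧ α.getLast? = some c then 1 else 0) := by
  rcases hd : α.getLast? with _ | d
  · rw [List.getLast?_eq_none_iff] at hd
    simp [hd, stem_nil, room]
  · obtain ⟨k, _, h2, _⟩ := stem_decomp hd
    have h3 := congrArg List.length h2
    have h4 := congrArg (List.count c) h2
    simp only [List.length_append, List.length_replicate, List.count_append,
      List.count_replicate] at h3 h4
    by_cases hdc : d = c
    · subst hdc
      by_cases hs : stem α = []
      · simp [hs, room, hd] at *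
        omega
      · simp [hs, room, hd] at *
        omega
    · simp [room, hd, hdc] at *
      omega

lemma Steps.trans {h : ℕ} {k l : ℕ} {S T U : B → List C} (h1 : Steps h k S T)
    (h2 : Steps h l T U) : Steps h (k + l) S U := by
  induction k generalizing S with
  | zero => obtain rfl : S = T := h1; simpa using h2
  | succ k ih =>
    obtain ⟨V, hV, h3⟩ := h1
    rw [Nat.succ_add]
    exact ⟨V, hV, ih h3⟩

lemma Steps.exists_path {h : ℕ} {k : ℕ} {S T : B → List C} (h1 : Steps h k S T) :
    ∃ f : ℕ → B → List C, f 0 = S ∧ (∀ i < k, BallMove h (f i) (f (i + 1))) ∧ f k = T := by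
  induction k generalizing S with
  | zero => exact ⟨fun _ => S, rfl, by simp, h1⟩
  | succ k ih =>
    obtain ⟨V, hV, h3⟩ := h1
    obtain ⟨f, hf0, hf, hfk⟩ := ih h3
    refine ⟨fun i => Nat.casesOn i S f, rfl, ?_, hfk⟩
    rintro (_ | i) hi
    · simpa [hf0] using hV
    · exact hf i (by omega)

lemma BallMove.config {h : ℕ} {S T : B → List C} (hm : BallMove h S T) (hS : Config h S) :
    Config h T := by
  obtain ⟨b₁, b₂, c, hne, h1, -, h3, h4, h5⟩ := hm
  intro b
  by_cases hb1 : b = b₁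
  · subst hb1
    have := hS b
    rw [h1] at this
    simp at this
    omega
  by_cases hb2 : b = b₂
  · rwa [hb2]
  · rw [h5 b hb1 hb2]; exact hS b

lemma BallMove.count [Fintype B] {h : ℕ} {S T : B → List C} (hm : BallMove h S T) (c : C) :
    ∑ b, (T b).count c = ∑ b, (S b).count c := by
  obtain ⟨b₁, b₂, d, hne, h1, -, h3, -, h5⟩ := hm
  have hb : b₂ ∈ Finset.univ.erase b₁ := by simp [hne.symm]
  rw [← Finset.add_sum_erase _ _ (Finset.mem_univ b₁), ← Finset.add_sum_erase _ _ hb,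
    ← Finset.add_sum_erase _ (fun b => (S b).count c) (Finset.mem_univ b₁),
    ← Finset.add_sum_erase _ (fun b => (S b).count c) hb]
  have : ∑ b ∈ (Finset.univ.erase b₁).erase b₂, (T b).count c
      = ∑ b ∈ (Finset.univ.erase b₁).erase b₂, (S b).count c := by
    refine Finset.sum_congr rfl fun b hb => ?_
    simp only [Finset.mem_erase, Finset.mem_univ, and_true] at hb
    rw [h5 b hb.2 hb.1]
  rw [this]
  simp only [h1, h3, List.count_append]
  omega

lemma Steps.config {h k : ℕ} {S T : B → List C} (hm : Steps h k S T) (hS : Config h S) :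
    Config h T := by
  induction k generalizing S with
  | zero => obtain rfl : S = T := hm; exact hS
  | succ k ih =>
    obtain ⟨V, hV, h3⟩ := hm
    exact ih h3 (hV.config hS)

lemma Steps.count [Fintype B] {h k : ℕ} {S T : B → List C} (hm : Steps h k S T) (c : C) :
    ∑ b, (T b).count c = ∑ b, (S b).count c := by
  induction k generalizing S with
  | zero => obtain rfl : S = T := hm; rfl
  | succ k ih =>
    obtain ⟨V, hV, h3⟩ := hm
    rw [ih h3, hV.count]

lemma ballMove_update {h : ℕ} {S : B → List C} {a b : B} {p : List C} {c : C} (hab : a ≠ b)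
    (hb : S b = p ++ [c]) (ha : S a = [] ∨ (S a).getLast? = some c) (hl : (S a).length < h) :
    BallMove h S (Function.update (Function.update S b p) a (S a ++ [c])) := by
  refine ⟨b, a, c, hab.symm, ?_, ha, by simp, by simpa using hl, ?_⟩
  · simp [Function.update_of_ne hab.symm, hb]
  · intro x h1 h2
    simp [Function.update_of_ne h1, Function.update_of_ne h2]

/-- The effect on a bin of pouring balls of color `c` onto it. -/
def Poured (c : C) (α β : List C) : Prop :=
  β = α ∨ (stem β = stem α ∧ β.getLast? = some c ∧ (α = [] ∨ α.getLast? = some c))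

lemma Poured.trans {c : C} {α β γ : List C} (h1 : Poured c α β) (h2 : Poured c β γ) :
    Poured c α γ := by
  rcases h1 with rfl | h1
  · exact h2
  · rcases h2 with rfl | h2
    · exact Or.inr h1
    · exact Or.inr ⟨h2.1.trans h1.1, h2.2.1, h1.2.2⟩

lemma Poured.push {c : C} {α : List C} (hα : α = [] ∨ α.getLast? = some c) :
    Poured c α (α ++ [c]) := Or.inr ⟨stem_push hα, by simp, hα⟩

lemma Poured.stem_eq {c : C} {α β : List C} (hp : Poured c α β) : stem β = stem α := by
  rcases hp with rfl | h
  · rfl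
  · exact h.1

lemma Poured.getLast?_eq {c : C} {α β : List C} (hp : Poured c α β) (hα : α ≠ []) :
    β.getLast? = α.getLast? := by
  rcases hp with rfl | ⟨-, h1, h2⟩
  · rfl
  · rw [h1, h2.resolve_left hα]

lemma Poured.getLast?_iff {c e : C} (he : e ≠ c) {α β : List C} (hp : Poured c α β) :
    β.getLast? = some e ↔ α.getLast? = some e := by
  rcases hp with rfl | ⟨-, h1, h2⟩
  · rfl
  · rcases h2 with rfl | h2
    · simp [h1, he.symm]
    · rw [h1, h2]

lemma Poured.room_eq {h : ℕ} {c e : C} (he : e ≠ c) {α β : List C} (hp : Poured c α β) :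
    room h e β = room h e α := by
  rcases hp with rfl | ⟨-, h1, h2⟩
  · rfl
  · rcases h2 with rfl | h2
    · simp [room, h1, he.symm]
    · simp [room, h1, h2, he.symm]

/-- Pouring the top `k` balls, all of color `c`, of the bin `b` onto other bins with top color `c`
that have enough room. -/
lemma exists_pour [Fintype B] {h k : ℕ} {S : B → List C} {b : B} {p : List C} {c : C}
    (hb : S b = p ++ List.replicate k c)
    (hk : k ≤ ∑ a ∈ Finset.univ.erase b, room h c (S a)) :
    ∃ T, Steps h k S T ∧ T b = p ∧ (∀ a, a ≠ b → Poured c (S a) (T a)) ∧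
      (∀ a, a ≠ b → (T a).getLast? = (S a).getLast?) ∧
      ∑ a ∈ Finset.univ.erase b, room h c (T a) + k =
        ∑ a ∈ Finset.univ.erase b, room h c (S a) := by
  induction k generalizing S with
  | zero =>
    exact ⟨S, rfl, by simpa using hb, fun _ _ => Or.inl rfl, fun _ _ => rfl, by simp⟩
  | succ k ih =>
    obtain ⟨a, ha, hroom⟩ : ∃ a ∈ Finset.univ.erase b, room h c (S a) ≠ 0 :=
      Finset.exists_ne_zero_of_sum_ne_zero (by omega)
    have hab : a ≠ b := by simpa using ha
    have htop : (S a).getLast? = some c := by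
      by_contra hne
      simp [room, hne] at hroom
    have hlen : (S a).length < h := by
      simp [room, htop] at hroom
      omega
    have hb' : S b = (p ++ List.replicate k c) ++ [c] := by
      rw [hb, List.replicate_succ', List.append_assoc]
    have hmove := ballMove_update hab hb' (Or.inr htop) hlen
    set U := Function.update (Function.update S b (p ++ List.replicate k c)) a (S a ++ [c]) with hU
    have hUb : U b = p ++ List.replicate k c := by simp [hU, Function.update_of_ne hab.symm]
    have hUa : U a = S a ++ [c] := by simp [hU]
    have hUx : ∀ x, x ≠ a → x ≠ b → U x = S x := fun x h1 h2 => by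
      simp [hU, Function.update_of_ne h1, Function.update_of_ne h2]
    have hsum : ∑ x ∈ Finset.univ.erase b, room h c (U x) + 1 =
        ∑ x ∈ Finset.univ.erase b, room h c (S x) := by
      rw [← Finset.add_sum_erase _ _ ha, ← Finset.add_sum_erase _ (fun x => room h c (S x)) ha]
      have h1 : room h c (U a) + 1 = room h c (S a) := by
        simp [room, hUa, htop]
        omega
      have h2 : ∑ x ∈ (Finset.univ.erase b).erase a, room h c (U x) =
          ∑ x ∈ (Finset.univ.erase b).erase a, room h c (S x) := by
        refine Finset.sum_congr rfl fun x hx => ?_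
        simp only [Finset.mem_erase, Finset.mem_univ, and_true] at hx
        rw [hUx x hx.1 hx.2]
      omega
    obtain ⟨T, hT1, hT2, hT3, hT4, hT5⟩ := ih hUb (by omega)
    refine ⟨T, ⟨U, hmove, hT1⟩, hT2, fun x hx => ?_, fun x hx => ?_, by omega⟩
    · refine Poured.trans ?_ (hT3 x hx)
      by_cases hxa : x = a
      · rw [hxa, hUa]; exact Poured.push (Or.inr htop)
      · rw [hUx x hxa hx]; exact Or.inl rfl
    · rw [hT4 x hx]
      by_cases hxa : x = a
      · rw [hxa, hUa, htop]; simp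
      · rw [hUx x hxa hx]

/-- Emptying the topmost block, of color `c`, of a non-monochrome bin, provided that there is enough
room for it or an empty bin. -/
lemma exists_evacuate [Fintype B] {h k : ℕ} {S : B → List C} {b : B} {p : List C} {c : C}
    (hh : 1 ≤ h) (hb : S b = p ++ List.replicate k c) (hk : 1 ≤ k) (hkh : k ≤ h)
    (hp : p.getLast? ≠ some c)
    (hroom : k ≤ ∑ a ∈ Finset.univ.erase b, room h c (S a) ∨ ∃ a, S a = [])
    (hpne : p ≠ []) (ht : TightAt h c S) :
    ∃ T, Steps h k S T ∧ T b = p ∧ (∀ a, a ≠ b → Poured c (S a) (T a)) ∧ TightAt h c T := by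
  have hpc : room h c p = 0 := by simp [room, hp]
  by_cases hle : k ≤ ∑ a ∈ Finset.univ.erase b, room h c (S a)
  · obtain ⟨T, hT1, hT2, hT3, hT4, hT5⟩ := exists_pour hb hle
    refine ⟨T, hT1, hT2, hT3, ?_⟩
    rcases ht with ht | ht
    · left
      intro a ha
      by_cases hab : a = b
      · rw [hab, hT2]; exact hp
      · rw [hT4 a hab]
        exact ht a ((hT3 a hab).stem_eq ▸ ha)
    · right
      rw [← Finset.add_sum_erase _ _ (Finset.mem_univ b)] at ht ⊢
      simp only [hT2, hpc]
      omega
  · obtain ⟨a, ha⟩ := hroom.resolve_left hle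
    have hab : a ≠ b := by
      rintro rfl
      rw [ha] at hb
      simp [hpne] at hb
    obtain ⟨j, rfl⟩ : ∃ j, k = j + 1 := ⟨k - 1, by omega⟩
    have hb' : S b = (p ++ List.replicate j c) ++ [c] := by
      rw [hb, List.replicate_succ', List.append_assoc]
    have hmove := ballMove_update hab hb' (Or.inl ha) (h := h) (by simp [ha]; omega)
    set U := Function.update (Function.update S b (p ++ List.replicate j c)) a (S a ++ [c]) with hU
    have hUb : U b = p ++ List.replicate j c := by simp [hU, Function.update_of_ne hab.symm]
    have hUa : U a = [c] := by simp [hU, ha]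
    have hUx : ∀ x, x ≠ a → x ≠ b → U x = S x := fun x h1 h2 => by
      simp [hU, Function.update_of_ne h1, Function.update_of_ne h2]
    have hmem : a ∈ Finset.univ.erase b := by simp [hab]
    have hsum : ∑ x ∈ Finset.univ.erase b, room h c (U x) =
        ∑ x ∈ Finset.univ.erase b, room h c (S x) + (h - 1) := by
      rw [← Finset.add_sum_erase _ _ hmem, ← Finset.add_sum_erase _ (fun x => room h c (S x)) hmem]
      have h1 : room h c (U a) = h - 1 := by simp [room, hUa]
      have h2 : room h c (S a) = 0 := by simp [room, ha]
      have h3 : ∑ x ∈ (Finset.univ.erase b).erase a, room h c (U x) =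
          ∑ x ∈ (Finset.univ.erase b).erase a, room h c (S x) := by
        refine Finset.sum_congr rfl fun x hx => ?_
        simp only [Finset.mem_erase, Finset.mem_univ, and_true] at hx
        rw [hUx x hx.1 hx.2]
      omega
    obtain ⟨T, hT1, hT2, hT3, hT4, hT5⟩ := exists_pour (h := h) hUb (by omega)
    refine ⟨T, ⟨U, hmove, hT1⟩, hT2, fun x hx => ?_, ?_⟩
    · refine Poured.trans ?_ (hT3 x hx)
      by_cases hxa : x = a
      · rw [hxa, hUa, ha]; exact Poured.push (Or.inl rfl)
      · rw [hUx x hxa hx]; exact Or.inl rfl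
    · right
      rw [← Finset.add_sum_erase _ _ (Finset.mem_univ b)]
      simp only [hT2, hpc]
      omega

/-- Restoring tightness at a single color by emptying at most one monochrome bin. -/
lemma exists_tighten [Fintype B] {h : ℕ} {S : B → List C} {d : C} (hS : Config h S)
    (ht : ∀ e, e ≠ d → TightAt h e S)
    (hd : ∑ b, room h d (S b) < 2 * h ∨
      ∃ b₀, ∀ b, stem (S b) = [] → (S b).getLast? = some d → b = b₀) :
    ∃ k T, k ≤ h ∧ Steps h k S T ∧ (∀ b, stem (T b) = stem (S b)) ∧
      (∀ b, stem (S b) ≠ [] → (T b).getLast? = (S b).getLast?) ∧ ∀ e, TightAt h e T := by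
  by_cases htd : TightAt h d S
  · refine ⟨0, S, Nat.zero_le _, rfl, fun _ => rfl, fun _ _ => rfl, fun e => ?_⟩
    by_cases he : e = d
    · exact he ▸ htd
    · exact ht e he
  simp only [TightAt, not_or, not_forall, not_not, not_lt] at htd
  obtain ⟨⟨b, hb1, hb2⟩, hge⟩ := htd
  obtain ⟨k, -, hbk, -⟩ := stem_decomp hb2
  rw [hb1] at hbk
  have hlen : (S b).length = k := by rw [hbk]; simp
  have hkh : k ≤ h := hlen ▸ hS b
  have hsplit := Finset.add_sum_erase _ (fun a => room h d (S a)) (Finset.mem_univ b)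
  have hrb : room h d (S b) = h - k := by simp [room, hb2, hlen]
  simp only [hrb] at hsplit
  obtain ⟨T, hT1, hT2, hT3, hT4, hT5⟩ := exists_pour (h := h) hbk (by omega)
  refine ⟨k, T, hkh, hT1, fun a => ?_, fun a ha => ?_, fun e => ?_⟩
  · by_cases hab : a = b
    · rw [hab, hT2, hb1, stem_nil]
    · exact (hT3 a hab).stem_eq
  · exact hT4 a (by rintro rfl; exact ha hb1)
  · have hmono : ∀ a, stem (T a) = [] → (T a).getLast? = some e →
        a ≠ b ∧ stem (S a) = [] ∧ (S a).getLast? = some e := by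
      intro a h1 h2
      have hab : a ≠ b := by
        rintro rfl
        simp [hT2] at h2
      exact ⟨hab, (hT3 a hab).stem_eq ▸ h1, hT4 a hab ▸ h2⟩
    have hsplitT := Finset.add_sum_erase _ (fun a => room h e (T a)) (Finset.mem_univ b)
    simp only [hT2, show room h e ([] : List C) = 0 by simp [room]] at hsplitT
    by_cases he : e = d
    · subst he
      rcases hd with hd | ⟨b₀, hd⟩
      · right; omega
      · left
        intro a h1 h2
        obtain ⟨h3, h4, h5⟩ := hmono a h1 h2
        exact h3 ((hd a h4 h5).trans (hd b hb1 hb2).symm)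
    · rcases ht e he with h1 | h1
      · left
        intro a h2 h3
        obtain ⟨-, h4, h5⟩ := hmono a h2 h3
        exact h1 a h4 h5
      · right
        rw [← Finset.add_sum_erase _ _ (Finset.mem_univ b)] at h1
        have : ∑ a ∈ Finset.univ.erase b, room h e (T a) =
            ∑ a ∈ Finset.univ.erase b, room h e (S a) :=
          Finset.sum_congr rfl fun a ha => (hT3 a (by simpa using ha)).room_eq he
        omega

/-- The number of nonempty monochrome bins of color `c`. -/
noncomputable def monoCount [Fintype B] (c : C) (S : B → List C) : ℕ :=
  ∑ b, if stem (S b) = [] ∧ (S b).getLast? = some c then 1 else 0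

/-- `S'` is a tight configuration with the same borders, the same top colors of non-monochrome bins
and the same balls as `S`. -/
structure Simulates [Fintype B] (h : ℕ) (S S' : B → List C) : Prop where
  config_left : Config h S
  config_right : Config h S'
  count_eq : ∀ c, ∑ b, (S b).count c = ∑ b, (S' b).count c
  stem_eq : ∀ b, stem (S b) = stem (S' b)
  top_eq : ∀ b, stem (S b) ≠ [] → (S b).getLast? = (S' b).getLast?
  tight : ∀ c, TightAt h c S'

lemma sum_count_add_sum_room [Fintype B] {h : ℕ} {S : B → List C} (hS : Config h S) (c : C) :
    ∑ b, (S b).count c + ∑ b, room h c (S b) = ∑ b, (stem (S b)).count c +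
      ∑ b, (if stem (S b) ≠ [] ∧ (S b).getLast? = some c then h - (stem (S b)).length else 0) +
      h * monoCount c S := by
  rw [monoCount, Finset.mul_sum, ← Finset.sum_add_distrib, ← Finset.sum_add_distrib,
    ← Finset.sum_add_distrib]
  exact Finset.sum_congr rfl fun b _ => count_add_room (hS b) c

lemma Simulates.balance [Fintype B] {h : ℕ} {S S' : B → List C} (hs : Simulates h S S') (c : C) :
    ∑ b, room h c (S b) + h * monoCount c S' = ∑ b, room h c (S' b) + h * monoCount c S := by
  have h1 := sum_count_add_sum_room hs.config_left c
  have h2 := sum_count_add_sum_room hs.config_right c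
  have h3 : ∑ b, (if stem (S b) ≠ [] ∧ (S b).getLast? = some c then h - (stem (S b)).length
      else 0) = ∑ b, (if stem (S' b) ≠ [] ∧ (S' b).getLast? = some c
      then h - (stem (S' b)).length else 0) := by
    refine Finset.sum_congr rfl fun b _ => ?_
    by_cases hb : stem (S b) = []
    · simp [← hs.stem_eq b, hb]
    · rw [← hs.stem_eq b, hs.top_eq b hb]
  simp only [hs.count_eq, hs.stem_eq] at h1 h2 h3
  omega

lemma TightAt.monoCount_eq_zero_or [Fintype B] {h : ℕ} {S : B → List C} {c : C}
    (ht : TightAt h c S) : monoCount c S = 0 ∨ ∑ b, room h c (S b) < h := by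
  refine ht.imp_left fun h1 => Finset.sum_eq_zero fun b _ => if_neg fun h2 => h1 b h2.1 h2.2

lemma Simulates.monoCount_le [Fintype B] {h : ℕ} {S S' : B → List C} (hs : Simulates h S S')
    (c : C) : monoCount c S' ≤ monoCount c S := by
  rcases (hs.tight c).monoCount_eq_zero_or with h1 | h1
  · omega
  · have h2 := hs.balance c
    by_contra! hlt
    have := Nat.mul_le_mul_left h (Nat.succ_le_of_lt hlt)
    rw [Nat.mul_succ] at this
    omega

lemma sum_monoCount_add [Fintype B] [Fintype C] (S : B → List C) :
    ∑ c, monoCount c S + ∑ b, (if S b = [] then 1 else 0) =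
      ∑ b, (if stem (S b) = [] then 1 else 0) := by
  simp only [monoCount]
  rw [Finset.sum_comm, ← Finset.sum_add_distrib]
  refine Finset.sum_congr rfl fun b _ => ?_
  rcases hd : (S b).getLast? with _ | d
  · rw [List.getLast?_eq_none_iff] at hd
    simp [hd, stem_nil]
  · have : S b ≠ [] := by
      intro h0
      simp [h0] at hd
    by_cases hs : stem (S b) = [] <;> simp [hs, this]

/-- If the simulating configuration has no empty bin, neither has the simulated one, and the
monochrome bins of the two configurations have the same colors. -/
lemma Simulates.of_forall_ne_nil [Fintype B] [Fintype C] {h : ℕ} {S S' : B → List C}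
    (hs : Simulates h S S') (hne : ∀ a, S' a ≠ []) :
    (∀ a, S a ≠ []) ∧ ∀ c, monoCount c S' = monoCount c S := by
  have h1 := sum_monoCount_add S
  have h2 := sum_monoCount_add S'
  simp only [hs.stem_eq] at h1
  have h3 : ∑ b, (if S' b = [] then 1 else 0) = 0 :=
    Finset.sum_eq_zero fun b _ => if_neg (hne b)
  have h4 := Finset.sum_le_sum fun c (_ : c ∈ Finset.univ) => hs.monoCount_le c
  constructor
  · intro a ha
    have : ∑ b, (if S b = [] then 1 else 0) = 0 := by omega
    rw [Finset.sum_eq_zero_iff] at this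
    simpa [ha] using this a (Finset.mem_univ a)
  · have h5 : ∑ c, monoCount c S' = ∑ c, monoCount c S := by omega
    rw [Finset.sum_eq_sum_iff_of_le fun c _ => hs.monoCount_le c] at h5
    exact fun c => h5 c (Finset.mem_univ c)

/-- A bin of `S` that is about to lose the last ball of its topmost block can be evacuated in every
configuration simulating `S`. -/
lemma Simulates.le_room_or_exists_empty [Fintype B] [Fintype C] {h k : ℕ} {S S' : B → List C}
    (hs : Simulates h S S') {b₁ b₂ : B} {p : List C} {c : C} (hne : b₁ ≠ b₂)
    (hb₁ : S b₁ = p ++ [c]) (hb₁' : S' b₁ = p ++ List.replicate k c) (hk : 1 ≤ k)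
    (hb₂ : S b₂ = [] ∨ (S b₂).getLast? = some c) (hlen : (S b₂).length < h) :
    k ≤ ∑ a ∈ Finset.univ.erase b₁, room h c (S' a) ∨ ∃ a, S' a = [] := by
  by_contra! hcon
  obtain ⟨hlt, hempty⟩ := hcon
  obtain ⟨h1, h2⟩ := hs.of_forall_ne_nil hempty
  have hbal := hs.balance c
  rw [h2 c] at hbal
  have htop := hb₂.resolve_left (h1 b₂)
  have hmem : b₂ ∈ Finset.univ.erase b₁ := by simp [hne.symm]
  rw [← Finset.add_sum_erase _ _ (Finset.mem_univ b₁), ← Finset.add_sum_erase _ _ hmem,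
    ← Finset.add_sum_erase _ (fun b => room h c (S' b)) (Finset.mem_univ b₁)] at hbal
  have h3 : room h c (S b₁) = h - (p.length + 1) := by simp [room, hb₁]
  have h4 : room h c (S b₂) = h - (S b₂).length := by simp [room, htop]
  have h5 : room h c (S' b₁) = h - (p.length + k) := by
    obtain ⟨j, rfl⟩ : ∃ j, k = j + 1 := ⟨k - 1, by omega⟩
    rw [hb₁', List.replicate_succ', ← List.append_assoc]
    simp [room]
  have h6 := hs.config_left b₁
  have h7 := hs.config_right b₁
  rw [hb₁] at h6
  rw [hb₁'] at h7
  simp only [List.length_append, List.length_replicate, List.length_singleton] at h6 h7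
  omega

/-- A move that changes no border is simulated by no move at all. -/
lemma Simulates.of_ballMove [Fintype B] {h : ℕ} {S S' T : B → List C} (hs : Simulates h S S')
    (hm : BallMove h S T) (hstem : ∀ b, stem (T b) = stem (S b))
    (htop : ∀ b, stem (S b) ≠ [] → (T b).getLast? = (S b).getLast?) : Simulates h T S' where
  config_left := hm.config hs.config_left
  config_right := hs.config_right
  count_eq c := (hm.count c).trans (hs.count_eq c)
  stem_eq b := (hstem b).trans (hs.stem_eq b)
  top_eq b hb := (htop b (hstem b ▸ hb)).trans (hs.top_eq b (hstem b ▸ hb))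
  tight := hs.tight

/-- Every ball-move from a simulated configuration is simulated at a cost of at most `2 h - 1`
ball-moves for each unit by which the borders descend. -/
lemma Simulates.exists_steps [Fintype B] [Fintype C] {h : ℕ} (hh : 1 ≤ h) {S S' T : B → List C}
    (hs : Simulates h S S') (hm : BallMove h S T) :
    ∃ k T', Steps h k S' T' ∧ Simulates h T T' ∧
      k + (2 * h - 1) * ∑ b, (stem (T' b)).length ≤
        (2 * h - 1) * ∑ b, (stem (S' b)).length := by
  obtain ⟨b₁, b₂, c, hne, h1, h2, h3, h4, h5⟩ := id hm
  have hstem₂ : stem (T b₂) = stem (S b₂) := by rw [h3, stem_push h2]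
  have htop₂ : stem (S b₂) ≠ [] → (T b₂).getLast? = (S b₂).getLast? := by
    intro hb
    have : S b₂ ≠ [] := by
      intro h0
      exact hb (by rw [h0, stem_nil])
    rw [h2.resolve_left this, h3]
    simp
  have hstem₁ := stem_append_singleton (T b₁) c
  rw [← h1] at hstem₁
  by_cases hcase : stem (T b₁) = stem (S b₁) ∧
      (stem (S b₁) ≠ [] → (T b₁).getLast? = (S b₁).getLast?)
  · refine ⟨0, S', rfl, hs.of_ballMove hm (fun b => ?_) (fun b => ?_), by simp⟩
    · by_cases hb1 : b = b₁
      · rw [hb1]; exact hcase.1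
      by_cases hb2 : b = b₂
      · rw [hb2]; exact hstem₂
      · rw [h5 b hb1 hb2]
    · by_cases hb1 : b = b₁
      · rw [hb1]; exact hcase.2
      by_cases hb2 : b = b₂
      · rw [hb2]; exact htop₂
      · intro _; rw [h5 b hb1 hb2]
  have hTc : (T b₁).getLast? ≠ some c := by
    intro hTc
    rw [if_pos hTc] at hstem₁
    exact hcase ⟨hstem₁.symm, fun _ => by rw [hTc, h1]; simp⟩
  rw [if_neg hTc] at hstem₁
  have hTne : T b₁ ≠ [] := by
    intro h0
    exact hcase ⟨by rw [hstem₁, h0, stem_nil], fun h6 => absurd (hstem₁.trans h0) h6⟩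
  set p := T b₁
  obtain ⟨d, hd⟩ : ∃ d, p.getLast? = some d :=
    Option.ne_none_iff_exists'.mp (by simpa using hTne)
  have hdc : d ≠ c := by
    rintro rfl
    exact hTc hd
  have htop₁ : (S' b₁).getLast? = some c := by
    rw [← hs.top_eq b₁ (hstem₁ ▸ hTne), h1]
    simp
  obtain ⟨k, hk, hdec, -⟩ := stem_decomp htop₁
  rw [← hs.stem_eq, hstem₁] at hdec
  have hlen : p.length + k ≤ h := by
    have := hs.config_right b₁
    rw [hdec] at this
    simpa using this
  have hplen : 1 ≤ p.length := List.length_pos_iff.mpr hTne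
  have hlen₂ : (S b₂).length < h := by
    rw [h3] at h4
    simpa using h4
  obtain ⟨U, hU1, hU2, hU3, hU4⟩ := exists_evacuate hh hdec hk (by omega) hTc
    (hs.le_room_or_exists_empty hne h1 hdec hk h2 hlen₂) hTne (hs.tight c)
  have hroom : ∀ e, e ≠ c → ∑ a ∈ Finset.univ.erase b₁, room h e (U a) =
      ∑ a ∈ Finset.univ.erase b₁, room h e (S' a) := fun e he =>
    Finset.sum_congr rfl fun a ha => (hU3 a (by simpa using ha)).room_eq he
  have hmono : ∀ e, e ≠ c → ∀ a, a ≠ b₁ → stem (U a) = [] → (U a).getLast? = some e →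
      stem (S' a) = [] ∧ (S' a).getLast? = some e := fun e he a ha h6 h7 =>
    ⟨(hU3 a ha).stem_eq ▸ h6, ((hU3 a ha).getLast?_iff he).mp h7⟩
  have htight : ∀ e, e ≠ d → TightAt h e U := by
    intro e hed
    by_cases hec : e = c
    · exact hec ▸ hU4
    rcases hs.tight e with h6 | h6
    · left
      intro a ha h7
      by_cases hab : a = b₁
      · rw [hab, hU2, hd] at h7
        exact hed (Option.some.inj h7).symm
      · obtain ⟨h8, h9⟩ := hmono e hec a hab ha h7
        exact h6 a h8 h9
    · right
      rw [← Finset.add_sum_erase _ _ (Finset.mem_univ b₁)] at h6 ⊢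
      rw [hroom e hec, hU2]
      have : room h e p = 0 := by simp [room, hd, Ne.symm hed]
      omega
  have hslack : ∑ b, room h d (U b) < 2 * h ∨
      ∃ b₀, ∀ b, stem (U b) = [] → (U b).getLast? = some d → b = b₀ := by
    rcases hs.tight d with h6 | h6
    · right
      refine ⟨b₁, fun b h7 h8 => ?_⟩
      by_contra hb
      obtain ⟨h9, h10⟩ := hmono d hdc b hb h7 h8
      exact h6 b h9 h10
    · left
      rw [← Finset.add_sum_erase _ _ (Finset.mem_univ b₁)] at h6 ⊢
      rw [hroom d hdc, hU2]
      have : room h d p = h - p.length := by simp [room, hd]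
      omega
  obtain ⟨l, T', hl, hT1, hT2, hT3, hT4⟩ :=
    exists_tighten (hU1.config hs.config_right) htight hslack
  have hsteps := hU1.trans hT1
  have hstemT : ∀ a, a ≠ b₁ → stem (T' a) = stem (S' a) := fun a ha =>
    (hT2 a).trans (hU3 a ha).stem_eq
  have hstemTS : ∀ a, a ≠ b₁ → stem (T a) = stem (S a) := by
    intro a ha
    by_cases hb2 : a = b₂
    · rw [hb2, hstem₂]
    · rw [h5 a ha hb2]
  refine ⟨k + l, T', hsteps, ⟨hm.config hs.config_left, hsteps.config hs.config_right, fun e => ?_,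
    fun a => ?_, fun a ha => ?_, hT4⟩, ?_⟩
  · rw [hm.count, hsteps.count, hs.count_eq]
  · by_cases hab : a = b₁
    · rw [hab, hT2, hU2]
    · rw [hstemT a hab, hstemTS a hab, hs.stem_eq]
  · by_cases hab : a = b₁
    · rw [hab] at ha ⊢
      rw [hT3 b₁ (by rwa [hU2]), hU2]
    · have hSa : stem (S a) ≠ [] := hstemTS a hab ▸ ha
      have hSa' : stem (S' a) ≠ [] := hs.stem_eq a ▸ hSa
      have hne' : S' a ≠ [] := by
        intro h0
        exact hSa' (by rw [h0, stem_nil])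
      rw [hT3 a (by rwa [(hU3 a hab).stem_eq]), (hU3 a hab).getLast?_eq hne', ← hs.top_eq a hSa]
      by_cases hb2 : a = b₂
      · rw [hb2] at hSa ⊢
        exact htop₂ hSa
      · rw [h5 a hab hb2]
  · have hlt : ∑ b, (stem (T' b)).length + 1 ≤ ∑ b, (stem (S' b)).length := by
      rw [← Finset.add_sum_erase _ _ (Finset.mem_univ b₁),
        ← Finset.add_sum_erase _ (fun b => (stem (S' b)).length) (Finset.mem_univ b₁)]
      have h6 : ∑ b ∈ Finset.univ.erase b₁, (stem (T' b)).length =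
          ∑ b ∈ Finset.univ.erase b₁, (stem (S' b)).length :=
        Finset.sum_congr rfl fun a ha => by rw [hstemT a (by simpa using ha)]
      have h7 : (stem (T' b₁)).length < (stem (S' b₁)).length := by
        rw [hT2, hU2, ← hs.stem_eq, hstem₁]
        obtain ⟨j, hj, h8, -⟩ := stem_decomp hd
        have := congrArg List.length h8
        simp only [List.length_append, List.length_replicate] at this
        omega
      omega
    calc k + l + (2 * h - 1) * ∑ b, (stem (T' b)).length
        ≤ (2 * h - 1) + (2 * h - 1) * ∑ b, (stem (T' b)).length := by
          gcongr
          omega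
      _ = (2 * h - 1) * (∑ b, (stem (T' b)).length + 1) := by ring
      _ ≤ _ := Nat.mul_le_mul_left _ hlt

lemma simulates_refl_of_initConfig [Fintype B] {h : ℕ} (hh : 1 ≤ h) {S : B → List C}
    (hS : InitConfig h S) : Simulates h S S where
  config_left b := by have := hS b; omega
  config_right b := by have := hS b; omega
  count_eq _ := rfl
  stem_eq _ := rfl
  top_eq _ _ := rfl
  tight c := by
    right
    rw [Finset.sum_eq_zero fun b _ => ?_]
    · omega
    · rcases hS b with h1 | h1
      · simp [room, h1]
      · simp [room, List.length_eq_zero_iff.mp h1]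

/-- A configuration simulating a sorted one is sorted. -/
lemma Simulates.sortedConfig [Fintype B] {h : ℕ} {S S' : B → List C}
    (hs : Simulates h S S') (hS : SortedConfig h S) : SortedConfig h S' := by
  intro b
  rcases hd : (S' b).getLast? with _ | c
  · exact Or.inl (by simpa using hd)
  right
  refine ⟨c, ?_⟩
  have hstem : stem (S' b) = [] := by
    rw [← hs.stem_eq]
    rcases hS b with h1 | ⟨e, h1⟩
    · rw [h1, stem_nil]
    · rw [h1, stem_replicate]
  obtain ⟨k, -, hk, -⟩ := stem_decomp hd
  rw [hstem, List.nil_append] at hk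
  have hlt : ∑ b, room h c (S' b) < h := (hs.tight c).resolve_left fun h1 => h1 b hstem hd
  have hbal := hs.balance c
  have hzero : ∑ b, room h c (S b) = 0 := by
    refine Finset.sum_eq_zero fun a _ => ?_
    rcases hS a with h1 | ⟨e, h1⟩ <;> simp [room, h1]
  rw [hzero, zero_add] at hbal
  have hdvd : h ∣ ∑ b, room h c (S' b) :=
    (Nat.dvd_add_left (dvd_mul_right h _)).mp (hbal ▸ dvd_mul_right h _)
  have hroom := Nat.eq_zero_of_dvd_of_lt hdvd hlt
  rw [Finset.sum_eq_zero_iff] at hroom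
  have h1 := hroom b (Finset.mem_univ b)
  have h2 := hs.config_right b
  have h3 : (S' b).length = k := by rw [hk]; simp
  simp only [room, hd, if_true] at h1
  rw [hk, show k = h by omega]

end BallSort

/-- every yes-instance of the ball sort puzzle with `n` full bins has a sorting
sequence of at most `(2h − 1)·h·n` ball-moves. -/
theorem statement_8 {B C : Type*} [Fintype B] [Fintype C] (h : ℕ) (hh : 1 ≤ h)
    (S₀ : B → List C) (hInit : InitConfig h S₀) (n : ℕ)
    (hn : (Finset.univ.filter (fun b : B => (S₀ b).length = h)).card = n)
    (hsolv : ∃ T : B → List C, SortedConfig h T ∧ Relation.ReflTransGen (BallMove h) S₀ T) :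
    ∃ ℓ ≤ (2 * h - 1) * h * n, ∃ f : ℕ → B → List C,
      f 0 = S₀ ∧ (∀ i < ℓ, BallMove h (f i) (f (i + 1))) ∧ SortedConfig h (f ℓ) := by
  obtain ⟨T, hT, hST⟩ := hsolv
  have key : ∃ k T', Steps h k S₀ T' ∧ Simulates h T T' ∧
      k + (2 * h - 1) * ∑ b, (stem (T' b)).length ≤
        (2 * h - 1) * ∑ b, (stem (S₀ b)).length := by
    clear hT
    induction hST with
    | refl => exact ⟨0, S₀, rfl, simulates_refl_of_initConfig hh hInit, by simp⟩
    | tail _ hm ih =>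
      obtain ⟨k, S', h1, h2, h3⟩ := ih
      obtain ⟨l, T', h4, h5, h6⟩ := h2.exists_steps hh hm
      exact ⟨k + l, T', h1.trans h4, h5, by omega⟩
  obtain ⟨k, T', h1, h2, h3⟩ := key
  obtain ⟨f, hf0, hf, hfk⟩ := h1.exists_path
  refine ⟨k, ?_, f, hf0, hf, hfk ▸ h2.sortedConfig hT⟩
  have hsum : ∑ b, (stem (S₀ b)).length ≤ h * n := by
    rw [← hn, Finset.card_filter, Finset.mul_sum]
    refine Finset.sum_le_sum fun b _ => (length_stem_le _).trans ?_
    rcases hInit b with h4 | h4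
    · simp [h4]
    · simp [h4]
  calc k ≤ (2 * h - 1) * ∑ b, (stem (S₀ b)).length := by omega
    _ ≤ (2 * h - 1) * (h * n) := Nat.mul_le_mul_left _ hsum
    _ = (2 * h - 1) * h * n := by ring
end
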